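/- Fix n ≥ 1 and regard the generalized Kronecker delta as the function T : (Fin n)^6 → ℝ, T(A,B,I,J,K,C) := δ^{ABC}_{IJK}. Then the complete antisymmetrisation of T over the four argument slots (A,B,I,J) vanishes identically, i.e. Σ_{ρ ∈ S₄} sgn(ρ) T(ρ(A),ρ(B),ρ(I),ρ(J),K,C) = 0 for all values of the six indices, where ρ permutes the four listed slots; the same holds for the complete antisymmetrisation over the slots (A,B,K,C) and over the slots (I,J,K,C). (These are the three vanishing identities used in the proof of maximality of the closing subset of quadratic simplicity constraints.) -/

import Mathlib

open scoped BigOperators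

/-- Ordinary Kronecker delta with values in `ℝ`. -/
def kron {n : ℕ} (a b : Fin n) : ℝ := if a = b then 1 else 0

/-- Generalized Kronecker delta
`δ^{ABC}_{IJK} = Σ_{σ ∈ S₃} sgn(σ) δ^A_{σ(I)} δ^B_{σ(J)} δ^C_{σ(K)}`. -/
noncomputable def gdelta {n : ℕ} (A B C I J K : Fin n) : ℝ :=
  ∑ σ : Equiv.Perm (Fin 3),
    ((Equiv.Perm.sign σ : ℤ) : ℝ) *
      (kron A (![I, J, K] (σ 0)) * kron B (![I, J, K] (σ 1)) * kron C (![I, J, K] (σ 2)))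

/-- The generalized Kronecker delta as a function of six index slots,
`T(A,B,I,J,K,C) := δ^{ABC}_{IJK}`. -/
noncomputable def Tdel {n : ℕ} (A B I J K C : Fin n) : ℝ := gdelta A B C I J K

/-- `gdelta` written out as a sum of six terms. -/
lemma gdelta_expand {n : ℕ} (A B C I J K : Fin n) :
    gdelta A B C I J K =
      kron A I * (kron B J * kron C K) - kron A J * (kron B I * kron C K)
      - kron A K * (kron B J * kron C I) - kron A I * (kron B K * kron C J)
      + kron A J * (kron B K * kron C I) + kron A K * (kron B I * kron C J) := by
  have h := Matrix.det_fin_three (Matrix.of fun i j : Fin 3 => kron (![A, B, C] j) (![I, J, K] i))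
  rw [Matrix.det_apply'] at h
  simp only [Fin.prod_univ_three, Matrix.of_apply] at h
  unfold gdelta
  simp at h ⊢
  rw [h]
  ring

/-- Antisymmetrising anything carrying a Kronecker delta in two of the slots gives zero. -/
lemma antisymm_zero {n : ℕ} (v : Fin 4 → Fin n) (i j : Fin 4) (hij : i ≠ j)
    (g : (Fin 4 → Fin n) → ℝ) :
    ∑ ρ : Equiv.Perm (Fin 4), ((Equiv.Perm.sign ρ : ℤ) : ℝ) *
      (kron (v (ρ i)) (v (ρ j)) * g (fun k => v (ρ k))) = 0 := by
  refine Finset.sum_involution (fun ρ _ => ρ * Equiv.swap i j) ?_ ?_ ?_ ?_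
  · intro ρ _
    by_cases h : v (ρ i) = v (ρ j)
    · have hv : (fun k => v ((ρ * Equiv.swap i j) k)) = fun k => v (ρ k) := by
        funext k
        rw [Equiv.Perm.mul_apply, Equiv.swap_apply_def]
        split_ifs with h1 h2
        · rw [h1, h]
        · rw [h2, h]
        · rfl
      rw [hv]
      simp [Equiv.Perm.sign_mul, Equiv.Perm.sign_swap hij, h]
    · simp [kron, h, Ne.symm h]
  · intro ρ _ _ h
    exact hij (Equiv.swap_eq_one_iff.mp (mul_eq_left.mp h))
  · intro ρ _
    exact Finset.mem_univ _
  · intro ρ _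
    simp [mul_assoc]

/-- the complete antisymmetrisations of `T` over the argument slots
`(A,B,I,J)`, over `(A,B,K,C)`, and over `(I,J,K,C)` all vanish identically. -/
theorem stmt6 (n : ℕ) (hn : 1 ≤ n) :
    (∀ A B I J K C : Fin n,
      ∑ ρ : Equiv.Perm (Fin 4), ((Equiv.Perm.sign ρ : ℤ) : ℝ) *
        Tdel (![A, B, I, J] (ρ 0)) (![A, B, I, J] (ρ 1))
          (![A, B, I, J] (ρ 2)) (![A, B, I, J] (ρ 3)) K C = 0) ∧
    (∀ A B I J K C : Fin n,
      ∑ ρ : Equiv.Perm (Fin 4), ((Equiv.Perm.sign ρ : ℤ) : ℝ) *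
        Tdel (![A, B, K, C] (ρ 0)) (![A, B, K, C] (ρ 1)) I J
          (![A, B, K, C] (ρ 2)) (![A, B, K, C] (ρ 3)) = 0) ∧
    (∀ A B I J K C : Fin n,
      ∑ ρ : Equiv.Perm (Fin 4), ((Equiv.Perm.sign ρ : ℤ) : ℝ) *
        Tdel A B (![I, J, K, C] (ρ 0)) (![I, J, K, C] (ρ 1))
          (![I, J, K, C] (ρ 2)) (![I, J, K, C] (ρ 3)) = 0) := by
  refine ⟨?_, ?_, ?_⟩
  · intro A B I J K C
    generalize ![A, B, I, J] = v
    have h0 := antisymm_zero v 0 2 (by decide) (fun w => kron (w 1) (w 3) * kron (C) (K))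
    have h1 := antisymm_zero v 0 3 (by decide) (fun w => kron (w 1) (w 2) * kron (C) (K))
    have h2 := antisymm_zero v 1 3 (by decide) (fun w => kron (w 0) (K) * kron (C) (w 2))
    have h3 := antisymm_zero v 0 2 (by decide) (fun w => kron (w 1) (K) * kron (C) (w 3))
    have h4 := antisymm_zero v 0 3 (by decide) (fun w => kron (w 1) (K) * kron (C) (w 2))
    have h5 := antisymm_zero v 1 2 (by decide) (fun w => kron (w 0) (K) * kron (C) (w 3))
    simp only [Tdel, gdelta_expand]
    have key := congrArg₂ (· + ·) (congrArg₂ (· - ·) (congrArg₂ (· - ·) (congrArg₂ (· - ·) h0 h1) h2) h3)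
      (congrArg₂ (· + ·) h4 h5)
    simp only [← Finset.sum_sub_distrib, ← Finset.sum_add_distrib] at key
    norm_num only at key
    rw [← key]
    refine Finset.sum_congr rfl fun ρ _ => ?_
    ring
  · intro A B I J K C
    generalize ![A, B, K, C] = v
    have h0 := antisymm_zero v 3 2 (by decide) (fun w => kron (w 0) (I) * kron (w 1) (J))
    have h1 := antisymm_zero v 3 2 (by decide) (fun w => kron (w 0) (J) * kron (w 1) (I))
    have h2 := antisymm_zero v 0 2 (by decide) (fun w => kron (w 1) (J) * kron (w 3) (I))
    have h3 := antisymm_zero v 1 2 (by decide) (fun w => kron (w 0) (I) * kron (w 3) (J))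
    have h4 := antisymm_zero v 1 2 (by decide) (fun w => kron (w 0) (J) * kron (w 3) (I))
    have h5 := antisymm_zero v 0 2 (by decide) (fun w => kron (w 1) (I) * kron (w 3) (J))
    simp only [Tdel, gdelta_expand]
    have key := congrArg₂ (· + ·) (congrArg₂ (· - ·) (congrArg₂ (· - ·) (congrArg₂ (· - ·) h0 h1) h2) h3)
      (congrArg₂ (· + ·) h4 h5)
    simp only [← Finset.sum_sub_distrib, ← Finset.sum_add_distrib] at key
    norm_num only at key
    rw [← key]
    refine Finset.sum_congr rfl fun ρ _ => ?_
    ring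
  · intro A B I J K C
    generalize ![I, J, K, C] = v
    have h0 := antisymm_zero v 3 2 (by decide) (fun w => kron (A) (w 0) * kron (B) (w 1))
    have h1 := antisymm_zero v 3 2 (by decide) (fun w => kron (A) (w 1) * kron (B) (w 0))
    have h2 := antisymm_zero v 3 0 (by decide) (fun w => kron (A) (w 2) * kron (B) (w 1))
    have h3 := antisymm_zero v 3 1 (by decide) (fun w => kron (A) (w 0) * kron (B) (w 2))
    have h4 := antisymm_zero v 3 0 (by decide) (fun w => kron (A) (w 1) * kron (B) (w 2))
    have h5 := antisymm_zero v 3 1 (by decide) (fun w => kron (A) (w 2) * kron (B) (w 0))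
    simp only [Tdel, gdelta_expand]
    have key := congrArg₂ (· + ·) (congrArg₂ (· - ·) (congrArg₂ (· - ·) (congrArg₂ (· - ·) h0 h1) h2) h3)
      (congrArg₂ (· + ·) h4 h5)
    simp only [← Finset.sum_sub_distrib, ← Finset.sum_add_distrib] at key
    norm_num only at key
    rw [← key]
    refine Finset.sum_congr rfl fun ρ _ => ?_
    ring
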